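/- Let p, n ≥ 1 and let H(x) = Σ_{i=0}^{n} x^i H_i be a matrix polynomial with H_i ∈ M_p(ℝ) and H_n invertible. Then det H(x) is a nonzero polynomial and for every ξ ∈ ℝ, dim Ker H(ξ) is at most the multiplicity of ξ as a root of det H(x). -/

import Mathlib

open Finset Matrix Polynomial

/-- The matrix polynomial `H(x) = ∑_{i=0}^{n} x^i H_i` as a `p × p` matrix over `ℝ[X]`. -/
noncomputable def matPoly (n p : ℕ) (H : ℕ → Matrix (Fin p) (Fin p) ℝ) :
    Matrix (Fin p) (Fin p) (Polynomial ℝ) :=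
  fun a b => ∑ i ∈ Finset.range (n + 1), Polynomial.C (H i a b) * Polynomial.X ^ i

theorem coeff_det_of_natDegree_le {m R : Type*} [Fintype m] [DecidableEq m] [CommRing R]
    (M : Matrix m m R[X]) (d : ℕ) (hM : ∀ a b, (M a b).natDegree ≤ d) :
    M.det.coeff (Fintype.card m * d) = (M.map fun f => f.coeff d).det := by
  rw [Matrix.det_apply, Matrix.det_apply, finsetSum_coeff]
  refine Finset.sum_congr rfl fun σ _ => ?_
  rw [Units.smul_def, Units.smul_def, coeff_smul, ← Finset.card_univ,
    coeff_prod_of_natDegree_le _ _ _ fun i _ => hM (σ i) i]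
  rfl

theorem pow_card_dvd_det_of_dvd_col {m R : Type*} [Fintype m] [DecidableEq m] [CommRing R]
    (M : Matrix m m R) (r : R) (s : Finset m) (h : ∀ j ∈ s, ∀ i, r ∣ M i j) :
    r ^ s.card ∣ M.det := by
  have key : ∀ i j, ∃ c, M i j = (if j ∈ s then r else 1) * c := by
    intro i j
    by_cases hj : j ∈ s
    · simpa [hj, dvd_def] using h j hj i
    · exact ⟨M i j, by simp [hj]⟩
  choose N hN using key
  have hMN : M = Matrix.of fun i j => (if j ∈ s then r else 1) * N i j := by
    ext i j
    exact hN i j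
  have hdet := Matrix.det_mul_row (fun j => if j ∈ s then r else 1) (Matrix.of N)
  rw [Finset.prod_ite_mem, Finset.univ_inter, Finset.prod_const] at hdet
  rw [hMN]
  refine Dvd.dvd.trans ?_ hdet.symm.dvd
  exact dvd_mul_right _ _

/-- Some invertible change of coordinates kills `dim ker A` columns of `A`. -/
theorem exists_isUnit_det_mul_col_eq_zero {m K : Type*} [Fintype m] [DecidableEq m] [Field K]
    (A : Matrix m m K) :
    ∃ (P : Matrix m m K) (s : Finset m), IsUnit P.det ∧
      s.card = Module.finrank K (LinearMap.ker A.mulVecLin) ∧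
      ∀ j ∈ s, ∀ i, (A * P) i j = 0 := by
  classical
  let v := Module.finBasis K (LinearMap.ker A.mulVecLin)
  have hv : LinearIndependent K fun i => (v i : m → K) :=
    v.linearIndependent.map' (Submodule.subtype _) (Submodule.ker_subtype _)
  let b := Module.Basis.sumExtend hv
  let e := b.indexEquiv (Pi.basisFun K m)
  let b' := b.reindex e
  refine ⟨(Pi.basisFun K m).toMatrix b',
    Finset.univ.map (Function.Embedding.inl.trans e.toEmbedding), ?_, by simp, ?_⟩
  · exact (Pi.basisFun K m).isUnit_det b'
  · intro j hj i
    obtain ⟨k, -, rfl⟩ := Finset.mem_map.mp hj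
    have hb : b' (e (Sum.inl k)) = (v k : m → K) := by
      simp only [b', b, Module.Basis.sumExtend, Module.Basis.reindex_apply,
        Equiv.symm_apply_apply, Module.Basis.extend_apply_self]
      rfl
    have hk : A *ᵥ (v k : m → K) = 0 := (v k).2
    have := congrFun hk i
    rw [← hb] at this
    exact this

theorem X_sub_C_pow_finrank_ker_dvd_det {m K : Type*} [Fintype m] [DecidableEq m] [Field K]
    (M : Matrix m m K[X]) (ξ : K) :
    (X - C ξ) ^ Module.finrank K (LinearMap.ker (M.map (eval ξ)).mulVecLin) ∣ M.det := by
  obtain ⟨P, s, hP, hs, hcol⟩ := exists_isUnit_det_mul_col_eq_zero (M.map (eval ξ))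
  have hdvd : (X - C ξ) ^ s.card ∣ (M * P.map C).det := by
    refine pow_card_dvd_det_of_dvd_col _ _ s fun j hj i => ?_
    rw [dvd_iff_isRoot, IsRoot.def, ← hcol j hj i]
    simp [Matrix.mul_apply, eval_finsetSum]
  have hPC : IsUnit (P.map C).det := by
    have : (P.map C).det = C P.det := (RingHom.map_det C P).symm
    rw [this]
    exact hP.map C
  rw [Matrix.det_mul] at hdvd
  rw [← hs]
  exact hPC.dvd_mul_right.mp hdvd

theorem matPoly_natDegree_le (n p : ℕ) (H : ℕ → Matrix (Fin p) (Fin p) ℝ) (a b : Fin p) :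
    (matPoly n p H a b).natDegree ≤ n :=
  natDegree_sum_le_of_forall_le _ _ fun _ hi =>
    (natDegree_C_mul_X_pow_le _ _).trans (Nat.lt_succ_iff.mp (Finset.mem_range.mp hi))

theorem matPoly_map_coeff (n p : ℕ) (H : ℕ → Matrix (Fin p) (Fin p) ℝ) :
    (matPoly n p H).map (fun f => f.coeff n) = H n := by
  ext a b
  simp [matPoly, finsetSum_coeff, coeff_X_pow]

theorem matPoly_map_eval (n p : ℕ) (H : ℕ → Matrix (Fin p) (Fin p) ℝ) (ξ : ℝ) :
    (matPoly n p H).map (eval ξ) = ∑ i ∈ Finset.range (n + 1), ξ ^ i • H i := by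
  ext a b
  simp [matPoly, eval_finsetSum, Matrix.sum_apply, mul_comm (ξ ^ _)]

/-- If `H_n` is invertible then `det H(x)` is a nonzero polynomial and, for every
`ξ ∈ ℝ`, `dim Ker H(ξ)` is at most the multiplicity of `ξ` as a root of `det H(x)`. -/
theorem kernel_dim_le_rootMultiplicity (p n : ℕ) (hp : 0 < p) (hn : 1 ≤ n)
    (H : ℕ → Matrix (Fin p) (Fin p) ℝ) (hHn : IsUnit (H n)) :
    (matPoly n p H).det ≠ 0 ∧
      ∀ ξ : ℝ,
        Module.finrank ℝ
            ↥(LinearMap.ker (∑ i ∈ Finset.range (n + 1), ξ ^ i • H i).mulVecLin) ≤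
          (matPoly n p H).det.rootMultiplicity ξ := by
  have hdet : (matPoly n p H).det ≠ 0 := by
    intro h0
    have h := coeff_det_of_natDegree_le _ n (matPoly_natDegree_le n p H)
    rw [h0, matPoly_map_coeff, coeff_zero] at h
    exact ((Matrix.isUnit_iff_isUnit_det _).mp hHn).ne_zero h.symm
  refine ⟨hdet, fun ξ => ?_⟩
  rw [le_rootMultiplicity_iff hdet, ← matPoly_map_eval]
  exact X_sub_C_pow_finrank_ker_dvd_det _ ξ
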